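/- Let 0 < γ < γ' ≤ 1 with u_h(γ) ≥ κ_S and β(γ') > 0. Then β(γ) − β(γ') ≥ (κ_S/R_n)·(γ' − γ); that is, on the region where it is positive, the inspection threshold β(·) decreases at rate at least κ_S/R_n. -/

import Mathlib

/-- The upper envelope function `u_h(γ) = max_j (γ R_j - c_j)`. -/
noncomputable def uh (n : ℕ) (hn : 0 < n) (R c : Fin n → ℝ) (γ : ℝ) : ℝ :=
  Finset.univ.sup' (Finset.univ_nonempty_iff.mpr (Fin.pos_iff_nonempty.mp hn))
    (fun j => γ * R j - c j)

/-- The inspection threshold `β(γ) = max{1 - δ(γ)/(γ(1-α)), 0}`. -/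
noncomputable def betaFn (α : ℝ) (δ : ℝ → ℝ) (γ : ℝ) : ℝ :=
  max (1 - δ γ / (γ * (1 - α))) 0

theorem le_uh {n : ℕ} (hn : 0 < n) (R c : Fin n → ℝ) (γ : ℝ) (j : Fin n) :
    γ * R j - c j ≤ uh n hn R c γ :=
  Finset.le_sup' (fun j => γ * R j - c j) (Finset.mem_univ j)

theorem exists_uh_eq {n : ℕ} (hn : 0 < n) (R c : Fin n → ℝ) (γ : ℝ) :
    ∃ j, uh n hn R c γ = γ * R j - c j := by
  obtain ⟨j, -, hj⟩ := Finset.exists_mem_eq_sup'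
    (Finset.univ_nonempty_iff.mpr (Fin.pos_iff_nonempty.mp hn)) (fun j => γ * R j - c j)
  exact ⟨j, hj⟩

theorem uh_strictMono {n : ℕ} (hn : 0 < n) {R : Fin n → ℝ} (c : Fin n → ℝ)
    (hR : ∀ j, 0 < R j) : StrictMono (uh n hn R c) := by
  intro x y hxy
  obtain ⟨j, hj⟩ := exists_uh_eq hn R c x
  linarith [le_uh hn R c y j, mul_lt_mul_of_pos_right hxy (hR j)]

theorem uh_sub_le {n : ℕ} (hn : 0 < n) {R : Fin n → ℝ} (c : Fin n → ℝ) {M x y : ℝ}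
    (hM : ∀ j, R j ≤ M) (hxy : x ≤ y) :
    uh n hn R c y - uh n hn R c x ≤ M * (y - x) := by
  obtain ⟨j, hj⟩ := exists_uh_eq hn R c y
  linarith [le_uh hn R c x j, mul_le_mul_of_nonneg_right (hM j) (sub_nonneg.mpr hxy)]

/-- Increments of the convex function `u_h` over intervals of fixed length `w` increase. -/
theorem uh_sub_uh_sub_le {n : ℕ} (hn : 0 < n) (R c : Fin n → ℝ) {x y w : ℝ}
    (hxy : x ≤ y) (hw : 0 ≤ w) :
    uh n hn R c x - uh n hn R c (x - w) ≤ uh n hn R c y - uh n hn R c (y - w) := by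
  obtain ⟨j, hj⟩ := exists_uh_eq hn R c x
  obtain ⟨k, hk⟩ := exists_uh_eq hn R c (y - w)
  rcases le_total (R j) (R k) with h | h
  · linarith [le_uh hn R c (x - w) j, le_uh hn R c y k, mul_le_mul_of_nonneg_left h hw]
  · linarith [le_uh hn R c (x - w) k, le_uh hn R c y j,
      mul_le_mul_of_nonneg_left h (sub_nonneg.mpr hxy)]

/-- for `0 < γ < γ' ≤ 1` with `u_h(γ) ≥ κ_S` and `β(γ') > 0`,
we have `β(γ) - β(γ') ≥ (κ_S / R_n) (γ' - γ)`. -/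
theorem betaFn_decreasing_rate
    (n : ℕ) (hn : 0 < n) (R c : Fin n → ℝ)
    (hc0 : 0 ≤ c ⟨0, hn⟩) (hc : StrictMono c)
    (hR0 : 0 < R ⟨0, hn⟩) (hR : StrictMono R)
    (κS : ℝ) (hκS : 0 < κS) (α : ℝ) (hα0 : 0 < α) (hα1 : α < 1)
    (δ : ℝ → ℝ)
    (hδ : ∀ γ ∈ Set.Ioc (0 : ℝ) 1, κS ≤ uh n hn R c γ →
      δ γ ∈ Set.Icc 0 γ ∧ uh n hn R c (δ γ) = uh n hn R c γ - κS)
    (γ γ' : ℝ) (hγ0 : 0 < γ) (hγγ' : γ < γ') (hγ'1 : γ' ≤ 1)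
    (hκ : κS ≤ uh n hn R c γ) (hpos : 0 < betaFn α δ γ') :
    betaFn α δ γ - betaFn α δ γ' ≥ (κS / R ⟨n - 1, by omega⟩) * (γ' - γ) := by
  have hRpos : ∀ j, 0 < R j := fun j =>
    hR0.trans_le (hR.monotone (Fin.le_def.mpr (Nat.zero_le _)))
  have hRle : ∀ j, R j ≤ R ⟨n - 1, by omega⟩ := fun j =>
    hR.monotone (Fin.le_def.mpr (Nat.le_sub_one_of_lt j.isLt))
  have hmono := uh_strictMono hn c hRpos
  have hγ'0 : 0 < γ' := hγ0.trans hγγ'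
  obtain ⟨⟨-, hdγ⟩, hu⟩ := hδ γ ⟨hγ0, hγγ'.le.trans hγ'1⟩ hκ
  obtain ⟨-, hu'⟩ := hδ γ' ⟨hγ'0, hγ'1⟩ (hκ.trans (hmono hγγ').le)
  have hgap : κS / R ⟨n - 1, by omega⟩ ≤ γ - δ γ := by
    rw [div_le_iff₀ (hRpos _)]
    linarith [uh_sub_le hn c hRle hdγ]
  have hgap' : γ' - δ γ' ≤ γ - δ γ := by
    have h := uh_sub_uh_sub_le hn R c hγγ'.le (sub_nonneg.mpr hdγ)
    rw [sub_sub_cancel] at h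
    have := hmono.le_iff_le.mp
      (show uh n hn R c (γ' - (γ - δ γ)) ≤ uh n hn R c (δ γ') by linarith)
    linarith
  generalize κS / R ⟨n - 1, by omega⟩ = r at hgap ⊢
  have h1α : 0 < 1 - α := by linarith
  have hβ : 1 - δ γ / (γ * (1 - α)) ≤ betaFn α δ γ := le_max_left _ _
  have hβ' : betaFn α δ γ' = 1 - δ γ' / (γ' * (1 - α)) :=
    max_eq_left ((lt_max_iff.mp hpos).resolve_right (lt_irrefl 0)).le
  have hnum : (γ - δ γ) * (γ' - γ) ≤ δ γ' * γ - δ γ * γ' := by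
    linarith [mul_le_mul_of_nonneg_right hgap' hγ0.le]
  have hden : γ * γ' * (1 - α) ≤ 1 :=
    mul_le_one₀ (mul_le_one₀ (hγγ'.le.trans hγ'1) hγ'0.le hγ'1) h1α.le (by linarith)
  have hdiff : δ γ' / (γ' * (1 - α)) - δ γ / (γ * (1 - α))
      = (δ γ' * γ - δ γ * γ') / (γ * γ' * (1 - α)) := by
    field_simp
  have hkey : r * (γ' - γ) ≤ (δ γ' * γ - δ γ * γ') / (γ * γ' * (1 - α)) := by
    have hle : 0 ≤ (γ - δ γ) * (γ' - γ) :=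
      mul_nonneg (sub_nonneg.mpr hdγ) (sub_nonneg.mpr hγγ'.le)
    rw [le_div_iff₀ (by positivity)]
    calc r * (γ' - γ) * (γ * γ' * (1 - α))
        ≤ (γ - δ γ) * (γ' - γ) * (γ * γ' * (1 - α)) := by gcongr
      _ ≤ (γ - δ γ) * (γ' - γ) := mul_le_of_le_one_right hle hden
      _ ≤ _ := hnum
  linarith
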